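/- For every projection game G and every integer k ≥ 1, val*(G^{⊗k})² ≤ ‖G^{⊗k}‖*² ≤ (val₊*(G))^k. -/

import Mathlib

noncomputable section
open scoped Kronecker ComplexOrder
open Matrix

/-- `d × d` complex matrices. -/
abbrev Mat (d : ℕ) := Matrix (Fin d) (Fin d) ℂ

/-- Entrywise complex conjugation of a matrix. -/
def mconj {m n : Type*} (M : Matrix m n ℂ) : Matrix m n ℂ := M.map (starRingEnd ℂ)

/-- Operator (spectral) norm of a square complex matrix. -/
noncomputable def opNorm {n : Type*} [Fintype n] [DecidableEq n] (M : Matrix n n ℂ) : ℝ :=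
  ‖Matrix.toEuclideanCLM (𝕜 := ℂ) M‖

/-- `⟨ψ| M |ψ⟩`. -/
def braket {ι : Type*} [Fintype ι] (ψ : ι → ℂ) (M : Matrix ι ι ℂ) : ℂ :=
  star ψ ⬝ᵥ M.mulVec ψ

/-- Squared Euclidean norm of a complex vector. -/
def enormSq {ι : Type*} [Fintype ι] (ψ : ι → ℂ) : ℝ := ∑ i, Complex.normSq (ψ i)

/-- A family of psd matrices summing to the identity. -/
def IsPOVM {d : ℕ} {α : Type*} [Fintype α] (M : α → Mat d) : Prop :=
  (∀ a, (M a).PosSemidef) ∧ (∑ a, M a) = 1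

/-- A two-player one-round projection game. -/
structure ProjGame where
  U : Type
  V : Type
  A : Type
  B : Type
  [fU : Fintype U]
  [fV : Fintype V]
  [fA : Fintype A]
  [fB : Fintype B]
  [dA : DecidableEq A]
  μ : U → V → ℝ
  μ_nonneg : ∀ u v, 0 ≤ μ u v
  μ_sum : ∑ u, ∑ v, μ u v = 1
  proj : U → V → B → Option A

attribute [instance] ProjGame.fU ProjGame.fV ProjGame.fA ProjGame.fB ProjGame.dA

namespace ProjGame

variable (G : ProjGame)

/-- Marginal distribution on first-player questions. -/
def μL (u : G.U) : ℝ := ∑ v, G.μ u v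

/-- Marginal distribution on second-player questions. -/
def μR (v : G.V) : ℝ := ∑ u, G.μ u v

/-- Conditional distribution `μ(v|u)`. -/
def μc (u : G.U) (v : G.V) : ℝ := G.μ u v / G.μL u

/-- A `d`-dimensional quantum strategy for the first player. -/
def IsStrategyA {d : ℕ} (A : G.U → G.A → Mat d) : Prop := ∀ u, IsPOVM (A u)

/-- A `d`-dimensional quantum strategy for the second player. -/
def IsStrategyB {d : ℕ} (B : G.V → G.B → Mat d) : Prop := ∀ v, IsPOVM (B v)

/-- Success probability of a pair of quantum strategies with shared state `ψ`. -/
def pay {d : ℕ} (A : G.U → G.A → Mat d) (B : G.V → G.B → Mat d)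
    (ψ : Fin d × Fin d → ℂ) : ℝ :=
  ∑ u, ∑ v, G.μ u v * ∑ a, ∑ b,
    if G.proj u v b = some a then (braket ψ (mconj (A u a) ⊗ₖ B v b)).re else 0

/-- The entangled value `val*(G)`. -/
noncomputable def entVal : ℝ :=
  sSup { x | ∃ (d : ℕ) (A : G.U → G.A → Mat d) (B : G.V → G.B → Mat d)
    (ψ : Fin d × Fin d → ℂ),
    G.IsStrategyA A ∧ G.IsStrategyB B ∧ enormSq ψ = 1 ∧ x = G.pay A B ψ }

/-- The operator `B_u^a = Σ_v μ(v|u) Σ_{b → a} B_v^b`. -/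
def Bop {d : ℕ} (B : G.V → G.B → Mat d) (u : G.U) (a : G.A) : Mat d :=
  ∑ v, ∑ b, if G.proj u v b = some a then (G.μc u v : ℂ) • B v b else 0

/-- The matrix `Σ_u μ(u) Σ_a conj(B_u^a) ⊗ B_u^a`. -/
def sqMat {d : ℕ} (B : G.V → G.B → Mat d) :
    Matrix (Fin d × Fin d) (Fin d × Fin d) ℂ :=
  ∑ u, (G.μL u : ℂ) • ∑ a, mconj (G.Bop B u a) ⊗ₖ G.Bop B u a

/-- The square norm `‖G‖*`. -/
noncomputable def sqNorm : ℝ :=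
  sSup { x | ∃ (d : ℕ) (B : G.V → G.B → Mat d), G.IsStrategyB B ∧
    x = Real.sqrt (opNorm (G.sqMat B)) }

/-- A vector quantum strategy over the finite measured space `Fin n`. -/
def IsVecStrategy {n d : ℕ} (A : Fin n → G.V → G.B → Mat d) : Prop :=
  ∀ i v, (∀ b, (A i v b).PosSemidef) ∧ ((1 : Mat d) - ∑ b, A i v b).PosSemidef

/-- The matrix `E_ω conj(A_{ωv}) ⊗ A_{ωv}` at a fixed `v`. -/
def vecMatAt {n d : ℕ} (w : Fin n → ℝ) (A : Fin n → G.V → G.B → Mat d) (v : G.V) :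
    Matrix (Fin d × Fin d) (Fin d × Fin d) ℂ :=
  ∑ i, (w i : ℂ) • (mconj (∑ b, A i v b) ⊗ₖ (∑ b, A i v b))

/-- The matrix appearing in the definition of `val₊*`. -/
def vecMat {n d : ℕ} (w : Fin n → ℝ) (A : Fin n → G.V → G.B → Mat d) :
    Matrix (Fin d × Fin d) (Fin d × Fin d) ℂ :=
  ∑ i, (w i : ℂ) • ∑ u, (G.μL u : ℂ) • ∑ a, ∑ v, ∑ v',
    ((G.μc u v * G.μc u v' : ℝ) : ℂ) • ∑ b, ∑ b',
      if G.proj u v b = some a ∧ G.proj u v' b' = some a then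
        mconj (A i v b) ⊗ₖ A i v' b' else 0

/-- The relaxed value `val₊*(G)`. -/
noncomputable def valPlus : ℝ :=
  sSup { x | ∃ (n d : ℕ) (w : Fin n → ℝ) (A : Fin n → G.V → G.B → Mat d),
    (∀ i, 0 < w i) ∧ G.IsVecStrategy A ∧
    (∀ v, Real.sqrt (opNorm (G.vecMatAt w A v)) ≤ 1) ∧
    x = opNorm (G.vecMat w A) }

/-- The product of two projection games. -/
def prod (H : ProjGame) : ProjGame where
  U := G.U × H.U
  V := G.V × H.V
  A := G.A × H.A
  B := G.B × H.B
  fU := inferInstance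
  fV := inferInstance
  fA := inferInstance
  fB := inferInstance
  dA := inferInstance
  μ := fun p q => G.μ p.1 q.1 * H.μ p.2 q.2
  μ_nonneg := fun p q => mul_nonneg (G.μ_nonneg _ _) (H.μ_nonneg _ _)
  μ_sum := by
    have h1 := G.μ_sum
    have h2 := H.μ_sum
    calc ∑ p : G.U × H.U, ∑ q : G.V × H.V, G.μ p.1 q.1 * H.μ p.2 q.2
        = ∑ p : G.U × H.U, (∑ v, G.μ p.1 v) * (∑ v', H.μ p.2 v') := by
          refine Finset.sum_congr rfl fun p _ => ?_
          rw [Fintype.sum_prod_type, Finset.sum_mul_sum]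
      _ = (∑ u, ∑ v, G.μ u v) * (∑ u', ∑ v', H.μ u' v') := by
          rw [Fintype.sum_prod_type, Finset.sum_mul_sum]
      _ = 1 := by rw [h1, h2, one_mul]
  proj := fun p q b =>
    (G.proj p.1 q.1 b.1).bind fun a => (H.proj p.2 q.2 b.2).map fun a' => (a, a')

/-- The `k`-fold repetition `G^{⊗k}` (junk value `G` at `k = 0`). -/
def pow : ℕ → ProjGame
  | 0 => G
  | 1 => G
  | (n+2) => G.prod (pow (n+1))

/-- The normalized Laplacian of the square of the constraint graph of `G`. -/
def lap [DecidableEq G.V] : Matrix G.V G.V ℝ :=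
  1 - Matrix.of fun v v' =>
    (Real.sqrt (G.μR v))⁻¹ * (∑ u, G.μL u * G.μc u v * G.μc u v') * (Real.sqrt (G.μR v'))⁻¹

end ProjGame

section OperatorNorm

open scoped Matrix.Norms.L2Operator MatrixOrder

variable {n : Type*}

lemma opNorm_eq_norm [Fintype n] [DecidableEq n] (M : Matrix n n ℂ) : opNorm M = ‖M‖ := rfl

lemma opNorm_nonneg [Fintype n] [DecidableEq n] (M : Matrix n n ℂ) : 0 ≤ opNorm M := norm_nonneg _

lemma opNorm_sum_le [Fintype n] [DecidableEq n] {ι : Type*} (s : Finset ι) (f : ι → Matrix n n ℂ) :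
    opNorm (∑ i ∈ s, f i) ≤ ∑ i ∈ s, opNorm (f i) := by
  simpa only [opNorm_eq_norm] using norm_sum_le s f

lemma opNorm_smul_of_nonneg [Fintype n] [DecidableEq n] {c : ℝ} (hc : 0 ≤ c) (M : Matrix n n ℂ) :
    opNorm ((c : ℂ) • M) = c * opNorm M := by
  rw [opNorm_eq_norm, norm_smul, Complex.norm_of_nonneg hc, opNorm_eq_norm]

lemma opNorm_one_le [Fintype n] [DecidableEq n] : opNorm (1 : Matrix n n ℂ) ≤ 1 := by
  rw [opNorm, map_one]
  exact ContinuousLinearMap.norm_id_le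

lemma opNorm_mono [Fintype n] [DecidableEq n] {M N : Matrix n n ℂ} (hM : 0 ≤ M) (hMN : M ≤ N) :
    opNorm M ≤ opNorm N := by
  simpa only [opNorm_eq_norm] using CStarAlgebra.norm_le_norm_of_nonneg_of_le hM hMN

lemma sqrt_enormSq [Fintype n] (ψ : n → ℂ) : √(enormSq ψ) = ‖WithLp.toLp 2 ψ‖ := by
  simp [EuclideanSpace.norm_eq, enormSq, Complex.normSq_eq_norm_sq]

lemma norm_dotProduct_mulVec_le [Fintype n] [DecidableEq n] (M : Matrix n n ℂ) (ψ φ : n → ℂ) :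
    ‖star ψ ⬝ᵥ M *ᵥ φ‖ ≤ opNorm M * √(enormSq ψ) * √(enormSq φ) := by
  have h : star ψ ⬝ᵥ M *ᵥ φ =
      inner ℂ (WithLp.toLp 2 ψ) (toEuclideanCLM (𝕜 := ℂ) M (WithLp.toLp 2 φ)) := by
    rw [toEuclideanCLM_toLp, EuclideanSpace.inner_toLp_toLp, dotProduct_comm]
  rw [h, sqrt_enormSq, sqrt_enormSq]
  calc _ ≤ ‖WithLp.toLp 2 ψ‖ * ‖toEuclideanCLM (𝕜 := ℂ) M (WithLp.toLp 2 φ)‖ :=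
        norm_inner_le_norm _ _
    _ ≤ ‖WithLp.toLp 2 ψ‖ * (opNorm M * ‖WithLp.toLp 2 φ‖) := by
        gcongr
        exact ContinuousLinearMap.le_opNorm _ _
    _ = _ := by ring

lemma opNorm_le_of_norm_dotProduct_le [Fintype n] [DecidableEq n] {M : Matrix n n ℂ} {C : ℝ}
    (hC : 0 ≤ C)
    (h : ∀ ψ φ, ‖star ψ ⬝ᵥ M *ᵥ φ‖ ≤ C * √(enormSq ψ) * √(enormSq φ)) : opNorm M ≤ C := by
  refine ContinuousLinearMap.opNorm_le_bound _ hC fun x => ?_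
  obtain ⟨φ, rfl⟩ : ∃ φ, x = WithLp.toLp 2 φ := ⟨x.ofLp, rfl⟩
  have h1 := h (M *ᵥ φ) φ
  rw [toEuclideanCLM_toLp]
  rw [sqrt_enormSq, sqrt_enormSq, dotProduct_comm, ← EuclideanSpace.inner_toLp_toLp,
    inner_self_eq_norm_sq_to_K] at h1
  simp only [norm_pow, RCLike.norm_ofReal, abs_norm] at h1
  rcases (norm_nonneg (WithLp.toLp 2 (M *ᵥ φ))).eq_or_lt with h0 | h0
  · rw [← h0]; positivity
  · exact le_of_mul_le_mul_right (by linarith) h0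

lemma enormSq_vec [Fintype n] (K : Matrix n n ℂ) : (enormSq (vec K) : ℂ) = (Kᴴ * K).trace := by
  rw [← star_vec_dotProduct_vec, enormSq, dotProduct, Complex.ofReal_sum]
  refine Finset.sum_congr rfl fun i _ => ?_
  rw [Complex.normSq_eq_conj_mul_self]
  rfl

lemma exists_eq_mul_enormSq_eq [Fintype n] [DecidableEq n] (K : Matrix n n ℂ) :
    ∃ K₁ K₂ : Matrix n n ℂ, K = K₁ * K₂ ∧ enormSq (vec (K₁ * K₁ᴴ)) = enormSq (vec K) ∧
      enormSq (vec (K₂ᴴ * K₂)) = enormSq (vec K) := by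
  have hpos := posSemidef_conjTranspose_mul_self K
  have hH := hpos.isHermitian
  set l : n → ℝ := hH.eigenvalues with hl
  have hl0 : ∀ i, 0 ≤ l i := hpos.eigenvalues_nonneg
  let U : Matrix n n ℂ := hH.eigenvectorUnitary.1
  have hUU : Uᴴ * U = 1 := Unitary.coe_star_mul_self hH.eigenvectorUnitary
  have hUU' : U * Uᴴ = 1 := Unitary.coe_mul_star_self hH.eigenvectorUnitary
  have hsp : Kᴴ * K = U * diagonal (fun i => (l i : ℂ)) * Uᴴ := by
    have := hH.spectral_theorem
    rwa [Unitary.conjStarAlgAut_apply] at this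
  have hD : Uᴴ * (Kᴴ * K) * U = diagonal (fun i => (l i : ℂ)) := by
    rw [hsp]
    calc _ = (Uᴴ * U) * diagonal (fun i => (l i : ℂ)) * (Uᴴ * U) := by noncomm_ring
      _ = _ := by rw [hUU]; simp
  set r : n → ℝ := fun i => √√(l i) with hr
  have hr4 : ∀ i, r i * r i * (r i * r i) = l i := fun i => by
    simp only [hr]
    rw [Real.mul_self_sqrt (Real.sqrt_nonneg _), Real.mul_self_sqrt (hl0 i)]
  have hR : ∀ f : n → ℝ, (diagonal (fun i => (f i : ℂ)))ᴴ = diagonal (fun i => (f i : ℂ)) := by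
    intro f
    rw [diagonal_conjTranspose]
    congr 1
    ext i
    simp
  have hKl : (enormSq (vec K) : ℂ) = ∑ i, (l i : ℂ) := by
    rw [enormSq_vec, hsp, trace_mul_comm, ← mul_assoc, hUU, one_mul, trace_diagonal]
  set R : Matrix n n ℂ := diagonal (fun i => (r i : ℂ)) with hRdef
  set S : Matrix n n ℂ := diagonal (fun i => ((r i)⁻¹ : ℝ) : n → ℂ) with hSdef
  have hRH : Rᴴ = R := hR r
  have hSH : Sᴴ = S := hR fun i => (r i)⁻¹
  have hr0 : ∀ i, r i = 0 → l i = 0 := fun i hi => by rw [← hr4 i, hi]; simp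
  have hker : K * U * (1 - S * R) = 0 := by
    rw [← conjTranspose_mul_self_eq_zero]
    have hE : 1 - S * R = diagonal (fun i => ((1 - (r i)⁻¹ * r i : ℝ) : ℂ)) := by
      rw [hSdef, hRdef, diagonal_mul_diagonal, ← diagonal_one, diagonal_sub]
      congr 1
      ext i
      simp
    rw [hE, conjTranspose_mul, conjTranspose_mul, hR]
    rw [show ∀ E : Matrix n n ℂ, E * (Uᴴ * Kᴴ) * (K * U * E) = E * (Uᴴ * (Kᴴ * K) * U) * E by
      intro E; noncomm_ring, hD, diagonal_mul_diagonal, diagonal_mul_diagonal,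
      diagonal_eq_zero]
    ext i
    by_cases hi : r i = 0
    · simp [hr0 i hi]
    · simp [hi]
  refine ⟨K * U * S, R * Uᴴ, ?_, ?_, ?_⟩
  · have h1 : K * U = K * U * (S * R) := by
      rw [mul_sub, mul_one, sub_eq_zero] at hker
      exact hker
    calc K = K * U * Uᴴ := by rw [mul_assoc, hUU', mul_one]
      _ = K * U * (S * R) * Uᴴ := by rw [← h1]
      _ = _ := by noncomm_ring
  · have h1 : (K * U * S)ᴴ * (K * U * S) = S * diagonal (fun i => (l i : ℂ)) * S := by
      rw [← hD, conjTranspose_mul, conjTranspose_mul, hSH]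
      noncomm_ring
    apply Complex.ofReal_injective
    rw [enormSq_vec, hKl, conjTranspose_mul, conjTranspose_conjTranspose, ← mul_assoc,
      trace_mul_comm]
    rw [show ∀ A : Matrix n n ℂ, Aᴴ * (A * Aᴴ * A) = (Aᴴ * A) * (Aᴴ * A) by
      intro A; noncomm_ring, h1, hSdef]
    simp only [diagonal_mul_diagonal, trace_diagonal]
    refine Finset.sum_congr rfl fun i _ => ?_
    by_cases hi : r i = 0
    · simp [hr0 i hi]
    · rw [← hr4 i]
      push_cast
      have : (r i : ℂ) ≠ 0 := by exact_mod_cast hi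
      field_simp
  · apply Complex.ofReal_injective
    rw [enormSq_vec, hKl]
    simp only [conjTranspose_mul, conjTranspose_conjTranspose, hRH]
    rw [show U * R * (R * Uᴴ) * (U * R * (R * Uᴴ)) = U * (R * R * (Uᴴ * U) * R * R) * Uᴴ by
      noncomm_ring, hUU, mul_one, trace_mul_comm, ← mul_assoc, hUU, one_mul, hRdef]
    simp only [diagonal_mul_diagonal, trace_diagonal]
    refine Finset.sum_congr rfl fun i _ => ?_
    rw [← hr4 i]
    push_cast
    ring

lemma norm_sum_trace_mul_le [Fintype n] {ι : Type*} [Fintype ι] (P Q : ι → Matrix n n ℂ) :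
    ‖∑ i, (P i * (Q i)ᴴ).trace‖ ≤
      √(∑ i, enormSq (vec (P i))) * √(∑ i, enormSq (vec (Q i))) := by
  have h1 : ∀ f : ι → Matrix n n ℂ, ∑ i, enormSq (vec (f i)) =
      ∑ x : ι × n × n, ‖vec (f x.1) x.2‖ ^ 2 := by
    intro f
    simp only [Fintype.sum_prod_type, enormSq, Complex.normSq_eq_norm_sq]
  rw [h1, h1]
  refine le_trans ?_ (Real.sum_mul_le_sqrt_mul_sqrt _ _ _)
  have h2 : ∑ i, (P i * (Q i)ᴴ).trace =
      ∑ x : ι × n × n, vec (P x.1) x.2 * star (vec (Q x.1) x.2) := by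
    simp only [Fintype.sum_prod_type]
    refine Finset.sum_congr rfl fun i _ => ?_
    rw [trace_mul_comm, ← star_vec_dotProduct_vec, dotProduct, Fintype.sum_prod_type]
    simp [mul_comm]
  rw [h2]
  refine (norm_sum_le _ _).trans (Finset.sum_le_sum fun x _ => ?_)
  simp

lemma mconj_transpose (X : Matrix n n ℂ) : (mconj X)ᵀ = Xᴴ := rfl

lemma star_vec_dotProduct_kronecker_mulVec_vec [Fintype n] (X Y K L : Matrix n n ℂ) :
    star (vec K) ⬝ᵥ (mconj X ⊗ₖ Y) *ᵥ vec L = (Kᴴ * (Y * L * Xᴴ)).trace := by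
  rw [kronecker_mulVec_vec, star_vec_dotProduct_vec, mconj_transpose]

lemma opNorm_sum_kronecker_le [Fintype n] [DecidableEq n] {ι : Type*} [Fintype ι]
    (X Y : ι → Matrix n n ℂ) :
    opNorm (∑ i, mconj (X i) ⊗ₖ Y i) ≤
      √(opNorm (∑ i, mconj (X i) ⊗ₖ X i)) * √(opNorm (∑ i, mconj (Y i) ⊗ₖ Y i)) := by
  have key : ∀ (Z : ι → Matrix n n ℂ) (K L : Matrix n n ℂ),
      ∑ i, enormSq (vec (Kᴴ * Z i * L)) ≤
        opNorm (∑ i, mconj (Z i) ⊗ₖ Z i) * √(enormSq (vec (K * Kᴴ))) *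
          √(enormSq (vec (L * Lᴴ))) := by
    intro Z K L
    refine le_trans (le_of_eq ?_) ((Complex.re_le_norm _).trans
      (norm_dotProduct_mulVec_le _ (vec (K * Kᴴ)) (vec (L * Lᴴ))))
    rw [sum_mulVec, dotProduct_sum, Complex.re_sum]
    refine Finset.sum_congr rfl fun i _ => ?_
    rw [star_vec_dotProduct_kronecker_mulVec_vec, ← Complex.ofReal_re (enormSq _), enormSq_vec]
    congr 1
    simp only [conjTranspose_mul, conjTranspose_conjTranspose]
    rw [show Lᴴ * ((Z i)ᴴ * K) * (Kᴴ * Z i * L) = Lᴴ * (Z i)ᴴ * (K * Kᴴ * Z i * L) by noncomm_ring,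
      trace_mul_comm]
    congr 1
    noncomm_ring
  refine opNorm_le_of_norm_dotProduct_le (by positivity) fun ψ φ => ?_
  obtain ⟨K, rfl⟩ := vec_bijective.surjective ψ
  obtain ⟨L, rfl⟩ := vec_bijective.surjective φ
  obtain ⟨K₁, K₂, hK, hK₁, hK₂⟩ := exists_eq_mul_enormSq_eq K
  obtain ⟨L₁, L₂, hL, hL₁, hL₂⟩ := exists_eq_mul_enormSq_eq L
  have hsum : star (vec K) ⬝ᵥ (∑ i, mconj (X i) ⊗ₖ Y i) *ᵥ vec L =
      ∑ i, ((K₁ᴴ * Y i * L₁) * (K₂ * X i * L₂ᴴ)ᴴ).trace := by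
    rw [sum_mulVec, dotProduct_sum]
    refine Finset.sum_congr rfl fun i _ => ?_
    rw [star_vec_dotProduct_kronecker_mulVec_vec, hK, hL]
    simp only [conjTranspose_mul, conjTranspose_conjTranspose]
    rw [mul_assoc, trace_mul_comm]
    congr 1
    noncomm_ring
  have hY := key Y K₁ L₁
  have hX := key X K₂ᴴ L₂ᴴ
  simp only [conjTranspose_conjTranspose] at hX
  rw [hK₁, hL₁] at hY
  rw [hK₂, hL₂] at hX
  rw [hsum]
  refine (norm_sum_trace_mul_le _ _).trans ?_
  refine (mul_le_mul (Real.sqrt_le_sqrt hY) (Real.sqrt_le_sqrt hX) (Real.sqrt_nonneg _)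
    (Real.sqrt_nonneg _)).trans (le_of_eq ?_)
  have hx := opNorm_nonneg (∑ i, mconj (X i) ⊗ₖ X i)
  have hy := opNorm_nonneg (∑ i, mconj (Y i) ⊗ₖ Y i)
  rw [mul_assoc, mul_assoc, Real.sqrt_mul hx, Real.sqrt_mul hy]
  have := Real.mul_self_sqrt (show 0 ≤ √(enormSq (vec K)) * √(enormSq (vec L)) by positivity)
  linear_combination √(opNorm (∑ i, mconj (X i) ⊗ₖ X i)) *
    √(opNorm (∑ i, mconj (Y i) ⊗ₖ Y i)) * this

lemma mconj_smul (c : ℝ) (X : Matrix n n ℂ) : mconj ((c : ℂ) • X) = (c : ℂ) • mconj X := by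
  ext i j
  simp [mconj]

lemma mconj_sum {ι : Type*} (s : Finset ι) (f : ι → Matrix n n ℂ) :
    mconj (∑ i ∈ s, f i) = ∑ i ∈ s, mconj (f i) :=
  map_sum (AddMonoidHom.mapMatrix (starRingEnd ℂ).toAddMonoidHom) f s

lemma kronecker_sqrt_smul {w : ℝ} (hw : 0 ≤ w) (X Y : Matrix n n ℂ) :
    mconj ((√w : ℂ) • X) ⊗ₖ ((√w : ℂ) • Y) = (w : ℂ) • (mconj X ⊗ₖ Y) := by
  rw [mconj_smul, smul_kronecker, kronecker_smul, smul_smul, ← Complex.ofReal_mul,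
    Real.mul_self_sqrt hw]

lemma opNorm_sum_smul_kronecker_le [Fintype n] [DecidableEq n] {ι : Type*} [Fintype ι] {w : ι → ℝ}
    (hw : ∀ i, 0 ≤ w i)
    (X Y : ι → Matrix n n ℂ) :
    opNorm (∑ i, (w i : ℂ) • (mconj (X i) ⊗ₖ Y i)) ≤
      √(opNorm (∑ i, (w i : ℂ) • (mconj (X i) ⊗ₖ X i))) *
        √(opNorm (∑ i, (w i : ℂ) • (mconj (Y i) ⊗ₖ Y i))) := by
  have := opNorm_sum_kronecker_le (fun i => (√(w i) : ℂ) • X i) (fun i => (√(w i) : ℂ) • Y i)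
  simpa only [kronecker_sqrt_smul (hw _)] using this

lemma mconj_nonneg {X : Matrix n n ℂ} (hX : 0 ≤ X) : 0 ≤ mconj X := by
  have h : mconj X = Xᵀ := by
    ext i j
    exact hX.posSemidef.isHermitian.apply j i
  rw [h]
  exact hX.posSemidef.transpose.nonneg

lemma mconj_sub (X Y : Matrix n n ℂ) : mconj (X - Y) = mconj X - mconj Y := by
  ext i j
  simp [mconj]

lemma mconj_one [DecidableEq n] : mconj (1 : Matrix n n ℂ) = 1 := by
  ext i j
  simp [mconj, one_apply, apply_ite]

lemma kronecker_nonneg [Fintype n] {X Y : Matrix n n ℂ} (hX : 0 ≤ X) (hY : 0 ≤ Y) : 0 ≤ X ⊗ₖ Y :=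
  (hX.posSemidef.kronecker hY.posSemidef).nonneg

lemma mconj_kronecker_mono [Fintype n] {X X' Y Y' : Matrix n n ℂ} (hX : 0 ≤ X) (hXX' : X ≤ X')
    (hY : 0 ≤ Y)
    (hYY' : Y ≤ Y') : mconj X ⊗ₖ Y ≤ mconj X' ⊗ₖ Y' := by
  have h : mconj X' ⊗ₖ Y' - mconj X ⊗ₖ Y = mconj (X' - X) ⊗ₖ Y' + mconj X ⊗ₖ (Y' - Y) := by
    rw [mconj_sub]
    ext i j
    simp [sub_mul, mul_sub]
  rw [← sub_nonneg, h]
  exact add_nonneg (kronecker_nonneg (mconj_nonneg (sub_nonneg.2 hXX')) (hY.trans hYY'))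
    (kronecker_nonneg (mconj_nonneg hX) (sub_nonneg.2 hYY'))

lemma ofReal_smul_nonneg {c : ℝ} (hc : 0 ≤ c) {X : Matrix n n ℂ} (hX : 0 ≤ X) :
    0 ≤ (c : ℂ) • X :=
  (hX.posSemidef.smul (Complex.zero_le_real.2 hc)).nonneg

lemma ofReal_smul_mono {c : ℝ} (hc : 0 ≤ c) {X Y : Matrix n n ℂ} (hXY : X ≤ Y) :
    (c : ℂ) • X ≤ (c : ℂ) • Y := by
  rw [← sub_nonneg, ← smul_sub]
  exact ofReal_smul_nonneg hc (sub_nonneg.2 hXY)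

lemma ofReal_smul_le_self {c : ℝ} (hc : c ≤ 1) {X : Matrix n n ℂ} (hX : 0 ≤ X) :
    (c : ℂ) • X ≤ X := by
  rw [← sub_nonneg, show X - (c : ℂ) • X = ((1 - c : ℝ) : ℂ) • X by
    rw [Complex.ofReal_sub, sub_smul, Complex.ofReal_one, one_smul]]
  exact ofReal_smul_nonneg (sub_nonneg.2 hc) hX

lemma opNorm_sum_kronecker_mono [Fintype n] [DecidableEq n] {ι : Type*} [Fintype ι] {w : ι → ℝ}
    (hw : ∀ i, 0 ≤ w i)
    {X Y : ι → Matrix n n ℂ} (hX : ∀ i, 0 ≤ X i) (hXY : ∀ i, X i ≤ Y i) :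
    opNorm (∑ i, (w i : ℂ) • (mconj (X i) ⊗ₖ X i)) ≤
      opNorm (∑ i, (w i : ℂ) • (mconj (Y i) ⊗ₖ Y i)) :=
  opNorm_mono
    (Finset.sum_nonneg fun i _ => ofReal_smul_nonneg (hw i)
      (kronecker_nonneg (mconj_nonneg (hX i)) (hX i)))
    (Finset.sum_le_sum fun i _ => ofReal_smul_mono (hw i)
      (mconj_kronecker_mono (hX i) (hXY i) (hX i) (hXY i)))

end OperatorNorm

section KroneckerSums

variable {m n ι : Type*}

lemma kronecker_sum_right (s : Finset ι) (X : Matrix m m ℂ) (f : ι → Matrix n n ℂ) :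
    X ⊗ₖ (∑ i ∈ s, f i) = ∑ i ∈ s, X ⊗ₖ f i := by
  ext i j
  simp [Matrix.sum_apply, Finset.mul_sum]

lemma sum_kronecker_left (s : Finset ι) (f : ι → Matrix m m ℂ) (X : Matrix n n ℂ) :
    (∑ i ∈ s, f i) ⊗ₖ X = ∑ i ∈ s, f i ⊗ₖ X := by
  ext i j
  simp [Matrix.sum_apply, Finset.sum_mul]

lemma mconj_ite_zero (p : Prop) [Decidable p] (X : Matrix n n ℂ) :
    mconj (if p then X else 0) = if p then mconj X else 0 := by
  split_ifs
  · rfl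
  · ext i j
    simp [mconj]

lemma ite_kronecker_ite (p q : Prop) [Decidable p] [Decidable q] (X Y : Matrix n n ℂ) :
    (if p then X else 0) ⊗ₖ (if q then Y else 0) = if p ∧ q then X ⊗ₖ Y else 0 := by
  by_cases hp : p <;> by_cases hq : q <;> simp [hp, hq]

lemma braket_sum [Fintype n] (s : Finset ι) (ψ : n → ℂ) (f : ι → Matrix n n ℂ) :
    braket ψ (∑ i ∈ s, f i) = ∑ i ∈ s, braket ψ (f i) := by
  simp only [braket, sum_mulVec, dotProduct_sum]

lemma braket_smul [Fintype n] (c : ℂ) (ψ : n → ℂ) (M : Matrix n n ℂ) :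
    braket ψ (c • M) = c * braket ψ M := by
  simp only [braket, smul_mulVec, dotProduct_smul, smul_eq_mul]

end KroneckerSums

namespace ProjGame

open scoped MatrixOrder

variable (G H : ProjGame)

lemma μL_nonneg (u : G.U) : 0 ≤ G.μL u := Finset.sum_nonneg fun _ _ => G.μ_nonneg _ _

lemma sum_μL : ∑ u, G.μL u = 1 := G.μ_sum

lemma μL_le_one (u : G.U) : G.μL u ≤ 1 := by
  rw [← G.sum_μL]
  exact Finset.single_le_sum (fun u _ => G.μL_nonneg u) (Finset.mem_univ u)

lemma μc_nonneg (u : G.U) (v : G.V) : 0 ≤ G.μc u v := div_nonneg (G.μ_nonneg _ _) (G.μL_nonneg _)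

lemma sum_μc_le_one (u : G.U) : ∑ v, G.μc u v ≤ 1 := by
  simp only [μc, ← Finset.sum_div]
  exact div_self_le_one (G.μL u)

lemma μc_le_one (u : G.U) (v : G.V) : G.μc u v ≤ 1 :=
  (Finset.single_le_sum (fun v _ => G.μc_nonneg u v) (Finset.mem_univ v)).trans (G.sum_μc_le_one u)

lemma μL_mul_μc (u : G.U) (v : G.V) : G.μL u * G.μc u v = G.μ u v := by
  by_cases h : G.μL u = 0
  · have h' := (Finset.sum_eq_zero_iff_of_nonneg fun v _ => G.μ_nonneg u v).1 h v
      (Finset.mem_univ v)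
    rw [h, h', zero_mul]
  · exact mul_div_cancel₀ _ h

variable {G H}

lemma Bop_nonneg {d : ℕ} {B : G.V → G.B → Mat d} (hB : ∀ v b, 0 ≤ B v b) (u : G.U) (a : G.A) :
    0 ≤ G.Bop B u a := by
  refine Finset.sum_nonneg fun v _ => Finset.sum_nonneg fun b _ => ?_
  split_ifs
  · exact ofReal_smul_nonneg (G.μc_nonneg u v) (hB v b)
  · exact le_rfl

lemma Bop_le {d : ℕ} {B : G.V → G.B → Mat d} (hB : ∀ v b, 0 ≤ B v b) (u : G.U) (a : G.A) :
    G.Bop B u a ≤ ∑ v, (G.μc u v : ℂ) • ∑ b, B v b := by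
  simp only [Finset.smul_sum]
  refine Finset.sum_le_sum fun v _ => Finset.sum_le_sum fun b _ => ?_
  split_ifs
  · exact le_rfl
  · exact ofReal_smul_nonneg (G.μc_nonneg u v) (hB v b)

lemma IsStrategyB.nonneg {d : ℕ} {B : G.V → G.B → Mat d} (hB : G.IsStrategyB B) (v : G.V)
    (b : G.B) : 0 ≤ B v b := ((hB v).1 b).nonneg

lemma Bop_le_one {d : ℕ} {B : G.V → G.B → Mat d} (hB : G.IsStrategyB B) (u : G.U) (a : G.A) :
    G.Bop B u a ≤ 1 := by
  refine (Bop_le hB.nonneg u a).trans ?_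
  simp only [(hB _).2, ← Finset.sum_smul, ← Complex.ofReal_sum]
  exact ofReal_smul_le_self (G.sum_μc_le_one u) PosSemidef.one.nonneg

lemma Bop_smul {d : ℕ} (c : ℂ) (B : G.V → G.B → Mat d) (u : G.U) (a : G.A) :
    G.Bop (fun v b => c • B v b) u a = c • G.Bop B u a := by
  simp only [Bop, Finset.smul_sum, smul_ite, smul_zero]
  simp only [smul_comm c]

lemma Bop_sum {d : ℕ} {ι : Type*} (s : Finset ι) (B : ι → G.V → G.B → Mat d) (u : G.U)
    (a : G.A) : G.Bop (fun v b => ∑ i ∈ s, B i v b) u a = ∑ i ∈ s, G.Bop (B i) u a := by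
  simp only [Bop, Finset.smul_sum]
  rw [Finset.sum_comm (s := s)]
  refine Finset.sum_congr rfl fun v _ => ?_
  rw [Finset.sum_comm (s := s)]
  refine Finset.sum_congr rfl fun b _ => ?_
  split_ifs <;> simp

lemma sqMat_sqrt_smul {d : ℕ} {c : ℝ} (hc : 0 ≤ c) (B : G.V → G.B → Mat d) :
    G.sqMat (fun v b => (√c : ℂ) • B v b) = (c : ℂ) • G.sqMat B := by
  simp only [sqMat, Bop_smul, kronecker_sqrt_smul hc, ← Finset.smul_sum]
  simp only [Finset.smul_sum, smul_comm (c : ℂ)]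

lemma mconj_Bop_kronecker_Bop {d : ℕ} (B : G.V → G.B → Mat d) (u : G.U) (a : G.A) :
    mconj (G.Bop B u a) ⊗ₖ G.Bop B u a = ∑ v, ∑ v', ((G.μc u v * G.μc u v' : ℝ) : ℂ) •
      ∑ b, ∑ b', if G.proj u v b = some a ∧ G.proj u v' b' = some a then
        mconj (B v b) ⊗ₖ B v' b' else 0 := by
  simp only [Bop, mconj_sum, mconj_ite_zero, mconj_smul, sum_kronecker_left, kronecker_sum_right,
    ite_kronecker_ite, smul_kronecker, kronecker_smul, smul_smul, Finset.smul_sum, smul_ite,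
    smul_zero, Complex.ofReal_mul]
  rw [Finset.sum_congr rfl fun v _ => Finset.sum_comm, Finset.sum_comm]
  refine Finset.sum_congr rfl fun v _ => Finset.sum_congr rfl fun v' _ => ?_
  rw [Finset.sum_comm]
  simp only [mul_comm]

lemma vecMat_eq_sum_sqMat {n d : ℕ} (w : Fin n → ℝ) (A : Fin n → G.V → G.B → Mat d) :
    G.vecMat w A = ∑ i, (w i : ℂ) • G.sqMat (A i) := by
  simp only [vecMat, sqMat, mconj_Bop_kronecker_Bop]

lemma opNorm_vecMat_le {n d : ℕ} {w : Fin n → ℝ} {A : Fin n → G.V → G.B → Mat d}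
    (hw : ∀ i, 0 ≤ w i) (hA : ∀ i v b, 0 ≤ A i v b) (h : ∀ v, opNorm (G.vecMatAt w A v) ≤ 1) :
    opNorm (G.vecMat w A) ≤ Fintype.card G.A * (Fintype.card G.V) ^ 2 := by
  have hZ : ∀ i v, 0 ≤ ∑ b, A i v b := fun i v => Finset.sum_nonneg fun b _ => hA i v b
  have h1 : ∀ u a, opNorm (∑ i, (w i : ℂ) • (mconj (G.Bop (A i) u a) ⊗ₖ G.Bop (A i) u a)) ≤
      (Fintype.card G.V : ℝ) ^ 2 := by
    intro u a
    refine (opNorm_sum_kronecker_mono hw (fun i => Bop_nonneg (hA i) u a)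
      (Y := fun i => ∑ v, ∑ b, A i v b) fun i => (Bop_le (hA i) u a).trans
        (Finset.sum_le_sum fun v _ => ofReal_smul_le_self (G.μc_le_one u v) (hZ i v))).trans ?_
    have h2 : ∑ i, (w i : ℂ) • (mconj (∑ v, ∑ b, A i v b) ⊗ₖ ∑ v, ∑ b, A i v b) =
        ∑ v, ∑ v', ∑ i, (w i : ℂ) • (mconj (∑ b, A i v b) ⊗ₖ ∑ b, A i v' b) := by
      simp only [mconj_sum _ fun v => ∑ b, A _ v b, sum_kronecker_left _ fun v => mconj _,
        kronecker_sum_right _ _ fun v => ∑ b, A _ v b, Finset.smul_sum]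
      rw [Finset.sum_comm]
      refine Finset.sum_congr rfl fun v _ => ?_
      rw [Finset.sum_comm]
    rw [h2]
    calc _ ≤ ∑ v : G.V, ∑ v' : G.V, (1 : ℝ) := by
          refine (opNorm_sum_le _ _).trans (Finset.sum_le_sum fun v _ =>
            (opNorm_sum_le _ _).trans (Finset.sum_le_sum fun v' _ => ?_))
          refine (opNorm_sum_smul_kronecker_le hw _ _).trans ?_
          exact mul_le_one₀ (Real.sqrt_le_one.2 (h v)) (Real.sqrt_nonneg _)
            (Real.sqrt_le_one.2 (h v'))
      _ = _ := by simp [sq]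
  have h2 : G.vecMat w A = ∑ u, (G.μL u : ℂ) • ∑ a, ∑ i,
      (w i : ℂ) • (mconj (G.Bop (A i) u a) ⊗ₖ G.Bop (A i) u a) := by
    simp only [vecMat_eq_sum_sqMat, sqMat, Finset.smul_sum]
    rw [Finset.sum_comm]
    refine Finset.sum_congr rfl fun u _ => ?_
    rw [Finset.sum_comm]
    simp only [smul_comm (G.μL u : ℂ)]
  rw [h2]
  calc _ ≤ ∑ u, G.μL u * ∑ a : G.A, (Fintype.card G.V : ℝ) ^ 2 := by
        refine (opNorm_sum_le _ _).trans (Finset.sum_le_sum fun u _ => ?_)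
        rw [opNorm_smul_of_nonneg (G.μL_nonneg u)]
        exact mul_le_mul_of_nonneg_left ((opNorm_sum_le _ _).trans
          (Finset.sum_le_sum fun a _ => h1 u a)) (G.μL_nonneg u)
    _ = _ := by rw [← Finset.sum_mul, G.sum_μL]; simp

lemma valPlus_nonneg : 0 ≤ G.valPlus := by
  refine Real.sSup_nonneg ?_
  rintro _ ⟨n, d, w, A, -, -, -, rfl⟩
  exact opNorm_nonneg _

lemma mul_opNorm_sum_sqMat_le_valPlus {Ω : Type*} [Fintype Ω] {d : ℕ} {c : ℝ} (hc : 0 < c)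
    {A : Ω → G.V → G.B → Mat d} (hA : ∀ i v b, 0 ≤ A i v b) (hA1 : ∀ i v, ∑ b, A i v b ≤ 1)
    (h : ∀ v, c * opNorm (∑ i, mconj (∑ b, A i v b) ⊗ₖ ∑ b, A i v b) ≤ 1) :
    c * opNorm (∑ i, G.sqMat (A i)) ≤ G.valPlus := by
  refine le_csSup ⟨Fintype.card G.A * (Fintype.card G.V) ^ 2, ?_⟩ ?_
  · rintro _ ⟨n, d, w, A, hw, hA, hn, rfl⟩
    exact opNorm_vecMat_le (fun i => (hw i).le) (fun i v b => ((hA i v).1 b).nonneg)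
      fun v => Real.sqrt_le_one.1 (hn v)
  · let e := Fintype.equivFin Ω
    refine ⟨Fintype.card Ω, d, fun _ => c, fun i => A (e.symm i), fun _ => hc,
      fun i v => ⟨fun b => (hA _ v b).posSemidef, hA1 _ v⟩, fun v => Real.sqrt_le_one.2 ?_, ?_⟩
    · rw [vecMatAt, ← Finset.smul_sum, opNorm_smul_of_nonneg hc.le,
        e.symm.sum_comp fun i => mconj (∑ b, A i v b) ⊗ₖ ∑ b, A i v b]
      exact h v
    · rw [vecMat_eq_sum_sqMat, ← Finset.smul_sum, opNorm_smul_of_nonneg hc.le,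
        e.symm.sum_comp fun i => G.sqMat (A i)]

lemma opNorm_sqMat_le_valPlus {d : ℕ} {B : G.V → G.B → Mat d} (hB : G.IsStrategyB B) :
    opNorm (G.sqMat B) ≤ G.valPlus := by
  have := mul_opNorm_sum_sqMat_le_valPlus (Ω := Unit) one_pos (A := fun _ => B)
    (fun _ => hB.nonneg) (fun _ v => (hB v).2.le) fun v => by
      simpa [(hB v).2, mconj_one] using opNorm_one_le
  simpa using this

lemma sqNorm_nonneg : 0 ≤ G.sqNorm := by
  refine Real.sSup_nonneg ?_
  rintro _ ⟨d, B, -, rfl⟩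
  exact Real.sqrt_nonneg _

lemma sqrt_opNorm_sqMat_le_sqNorm {d : ℕ} {B : G.V → G.B → Mat d} (hB : G.IsStrategyB B) :
    √(opNorm (G.sqMat B)) ≤ G.sqNorm := by
  refine le_csSup ⟨√G.valPlus, ?_⟩ ⟨d, B, hB, rfl⟩
  rintro _ ⟨d, B, hB, rfl⟩
  exact Real.sqrt_le_sqrt (opNorm_sqMat_le_valPlus hB)

lemma opNorm_sqMat_le_sqNorm_sq {d : ℕ} {B : G.V → G.B → Mat d} (hB : G.IsStrategyB B) :
    opNorm (G.sqMat B) ≤ G.sqNorm ^ 2 :=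
  (Real.sqrt_le_left sqNorm_nonneg).1 (sqrt_opNorm_sqMat_le_sqNorm hB)

lemma sqNorm_sq_le {C : ℝ} (hC : 0 ≤ C)
    (h : ∀ (d : ℕ) (B : G.V → G.B → Mat d), G.IsStrategyB B → opNorm (G.sqMat B) ≤ C) :
    G.sqNorm ^ 2 ≤ C := by
  rw [← Real.le_sqrt sqNorm_nonneg hC]
  refine Real.sSup_le ?_ (Real.sqrt_nonneg C)
  rintro _ ⟨d, B, hB, rfl⟩
  exact Real.sqrt_le_sqrt (h d B hB)

lemma pay_eq {d : ℕ} (A : G.U → G.A → Mat d) (B : G.V → G.B → Mat d) (ψ : Fin d × Fin d → ℂ) :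
    G.pay A B ψ =
      (braket ψ (∑ x : G.U × G.A, (G.μL x.1 : ℂ) •
        (mconj (A x.1 x.2) ⊗ₖ G.Bop B x.1 x.2))).re := by
  rw [Fintype.sum_prod_type]
  simp only [braket_sum, braket_smul, Complex.re_sum, Complex.re_ofReal_mul, Bop,
    kronecker_sum_right, pay]
  refine Finset.sum_congr rfl fun u _ => ?_
  rw [← Finset.mul_sum, Finset.sum_comm, Finset.mul_sum]
  refine Finset.sum_congr rfl fun v _ => ?_
  rw [← G.μL_mul_μc, mul_assoc, Finset.mul_sum]
  congr 1
  refine Finset.sum_congr rfl fun a _ => ?_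
  rw [Finset.mul_sum]
  refine Finset.sum_congr rfl fun b _ => ?_
  split_ifs
  · rw [kronecker_smul, braket_smul, Complex.re_ofReal_mul]
  · simp [braket]

lemma IsStrategyA.opNorm_le_one {d : ℕ} {A : G.U → G.A → Mat d} (hA : G.IsStrategyA A) :
    opNorm (∑ x : G.U × G.A, (G.μL x.1 : ℂ) • (mconj (A x.1 x.2) ⊗ₖ A x.1 x.2)) ≤ 1 := by
  have h0 : ∀ u a, 0 ≤ A u a := fun u a => ((hA u).1 a).nonneg
  have h1 : ∀ u a, A u a ≤ 1 := fun u a => by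
    rw [← (hA u).2]
    exact Finset.single_le_sum (fun a _ => h0 u a) (Finset.mem_univ a)
  have h2 : ∑ x : G.U × G.A, (G.μL x.1 : ℂ) • (mconj (A x.1 x.2) ⊗ₖ (1 : Mat d)) = 1 := by
    simp only [Fintype.sum_prod_type, ← Finset.smul_sum, ← sum_kronecker_left, ← mconj_sum,
      (hA _).2, mconj_one, one_kronecker_one, ← Finset.sum_smul, ← Complex.ofReal_sum, G.sum_μL,
      Complex.ofReal_one, one_smul]
  refine (opNorm_mono ?_ (le_of_le_of_eq (Finset.sum_le_sum fun x _ => ?_) h2)).trans opNorm_one_le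
  · exact Finset.sum_nonneg fun x _ => ofReal_smul_nonneg (G.μL_nonneg _)
      (kronecker_nonneg (mconj_nonneg (h0 _ _)) (h0 _ _))
  · exact ofReal_smul_mono (G.μL_nonneg _)
      (mconj_kronecker_mono (h0 _ _) le_rfl (h0 _ _) (h1 _ _))

lemma abs_pay_le_sqNorm {d : ℕ} {A : G.U → G.A → Mat d} {B : G.V → G.B → Mat d}
    {ψ : Fin d × Fin d → ℂ} (hA : G.IsStrategyA A) (hB : G.IsStrategyB B) (hψ : enormSq ψ = 1) :
    |G.pay A B ψ| ≤ G.sqNorm := by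
  rw [pay_eq]
  refine (Complex.abs_re_le_norm _).trans ((norm_dotProduct_mulVec_le _ ψ ψ).trans ?_)
  rw [hψ, Real.sqrt_one, mul_one, mul_one]
  refine (opNorm_sum_smul_kronecker_le (fun x => G.μL_nonneg _) _ _).trans ?_
  rw [← one_mul G.sqNorm]
  refine mul_le_mul (Real.sqrt_le_one.2 hA.opNorm_le_one) ?_ (Real.sqrt_nonneg _) zero_le_one
  refine le_of_eq_of_le ?_ (sqrt_opNorm_sqMat_le_sqNorm hB)
  simp only [sqMat, Fintype.sum_prod_type, Finset.smul_sum]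

lemma entVal_sq_le_sqNorm_sq : G.entVal ^ 2 ≤ G.sqNorm ^ 2 := by
  rw [sq_le_sq, abs_of_nonneg sqNorm_nonneg, abs_le, entVal]
  set S := { x | ∃ (d : ℕ) (A : G.U → G.A → Mat d) (B : G.V → G.B → Mat d)
    (ψ : Fin d × Fin d → ℂ),
    G.IsStrategyA A ∧ G.IsStrategyB B ∧ enormSq ψ = 1 ∧ x = G.pay A B ψ }
  have hS : ∀ x ∈ S, |x| ≤ G.sqNorm := by
    rintro _ ⟨d, A, B, ψ, hA, hB, hψ, rfl⟩
    exact abs_pay_le_sqNorm hA hB hψ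
  refine ⟨?_, Real.sSup_le (fun x hx => (abs_le.1 (hS x hx)).2) sqNorm_nonneg⟩
  rcases S.eq_empty_or_nonempty with hE | ⟨x, hx⟩
  · rw [hE, Real.sSup_empty]
    exact neg_nonpos.2 sqNorm_nonneg
  · exact (abs_le.1 (hS x hx)).1.trans
      (le_csSup ⟨G.sqNorm, fun y hy => (abs_le.1 (hS y hy)).2⟩ hx)

lemma μL_prod (u : G.U) (u' : H.U) : (G.prod H).μL (u, u') = G.μL u * H.μL u' := by
  simp only [μL, Finset.sum_mul_sum]
  exact Fintype.sum_prod_type _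

lemma μc_prod (u : G.U) (u' : H.U) (v : G.V) (v' : H.V) :
    (G.prod H).μc (u, u') (v, v') = G.μc u v * H.μc u' v' := by
  rw [μc, μc, div_mul_div_comm, ← μL_prod]
  rfl

lemma proj_prod_eq_some (u : G.U) (u' : H.U) (v : G.V) (v' : H.V) (b : G.B) (b' : H.B) (a : G.A)
    (a' : H.A) : (G.prod H).proj (u, u') (v, v') (b, b') = (some (a, a') : Option (G.prod H).A) ↔
      G.proj u v b = some a ∧ H.proj u' v' b' = some a' := by
  change ((G.proj u v b).bind fun a => (H.proj u' v' b').map fun a' => (a, a')) =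
    (some (a, a') : Option (G.A × H.A)) ↔ _
  rcases G.proj u v b with _ | x <;> rcases H.proj u' v' b' with _ | y <;> simp

lemma Bop_prod {d : ℕ} (B : (G.prod H).V → (G.prod H).B → Mat d) (u : G.U) (u' : H.U) (a : G.A)
    (a' : H.A) : (G.prod H).Bop B (u, u') (a, a') =
      G.Bop (fun v b => H.Bop (fun v' b' => B (v, v') (b, b')) u' a') u a := by
  have hterm : ∀ v v' b b', (if (G.prod H).proj (u, u') (v, v') (b, b') =
      (some (a, a') : Option (G.prod H).A) then
      ((G.prod H).μc (u, u') (v, v') : ℂ) • B (v, v') (b, b') else 0) =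
      if G.proj u v b = some a then (G.μc u v : ℂ) • (if H.proj u' v' b' = some a' then
        (H.μc u' v' : ℂ) • B (v, v') (b, b') else 0) else 0 := fun v v' b b' => by
    refine (if_congr (proj_prod_eq_some u u' v v' b b' a a') rfl rfl).trans ?_
    rw [ite_and]
    split_ifs
    · rw [smul_smul, ← Complex.ofReal_mul, μc_prod]
    · rw [smul_zero]
    · rfl
  refine (Fintype.sum_prod_type _).trans (Finset.sum_congr rfl fun v _ => ?_)
  refine (Finset.sum_congr rfl fun v' _ => (Fintype.sum_prod_type _).trans
    (Finset.sum_congr rfl fun b _ => Finset.sum_congr rfl fun b' _ => hterm v v' b b')).trans ?_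
  rw [Finset.sum_comm]
  refine Finset.sum_congr rfl fun b _ => ?_
  split_ifs
  · simp only [Bop, Finset.smul_sum]
  · simp

lemma sqMat_prod {d : ℕ} (B : (G.prod H).V → (G.prod H).B → Mat d) :
    (G.prod H).sqMat B = ∑ x : H.U × H.A, G.sqMat fun v b =>
      (√(H.μL x.1) : ℂ) • H.Bop (fun v' b' => B (v, v') (b, b')) x.1 x.2 := by
  simp only [sqMat_sqrt_smul (H.μL_nonneg _)]
  simp only [sqMat, Fintype.sum_prod_type, Finset.smul_sum, smul_smul]
  refine (Fintype.sum_prod_type _).trans ?_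
  rw [Finset.sum_comm]
  refine Finset.sum_congr rfl fun u' _ => ?_
  refine .trans (Finset.sum_congr rfl fun u _ => ?_) Finset.sum_comm
  refine (Fintype.sum_prod_type_right _).trans ?_
  simp only [Bop_prod, μL_prod, Complex.ofReal_mul, mul_comm]

lemma mul_opNorm_sqMat_prod_le {d : ℕ} {B : (G.prod H).V → (G.prod H).B → Mat d}
    (hB : (G.prod H).IsStrategyB B) {t : ℝ} (ht : 0 < t) (hts : t * H.sqNorm ^ 2 ≤ 1) :
    t * opNorm ((G.prod H).sqMat B) ≤ G.valPlus := by
  have hBv : ∀ v, H.IsStrategyB fun v' b' => ∑ b, B (v, v') (b, b') := fun v v' =>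
    ⟨fun b' => (Finset.sum_nonneg fun b _ => hB.nonneg _ _).posSemidef, by
      rw [Finset.sum_comm, ← (hB (v, v')).2]
      exact (Fintype.sum_prod_type _).symm⟩
  have hsum : ∀ (x : H.U × H.A) v, ∑ b, (√(H.μL x.1) : ℂ) •
      H.Bop (fun v' b' => B (v, v') (b, b')) x.1 x.2 =
      (√(H.μL x.1) : ℂ) • H.Bop (fun v' b' => ∑ b, B (v, v') (b, b')) x.1 x.2 := fun x v => by
    rw [← Finset.smul_sum, Bop_sum]
  rw [sqMat_prod]
  refine mul_opNorm_sum_sqMat_le_valPlus ht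
    (fun x v b => ofReal_smul_nonneg (Real.sqrt_nonneg _)
      (Bop_nonneg (fun _ _ => hB.nonneg _ _) _ _))
    (fun x v => ?_) fun v => ?_
  · rw [hsum]
    exact (ofReal_smul_le_self (Real.sqrt_le_one.2 (H.μL_le_one _))
      (Bop_nonneg (hBv v).nonneg _ _)).trans (Bop_le_one (hBv v) _ _)
  · refine le_trans (mul_le_mul_of_nonneg_left (le_of_eq_of_le ?_
      (opNorm_sqMat_le_sqNorm_sq (hBv v))) ht.le) hts
    simp only [hsum, kronecker_sqrt_smul (H.μL_nonneg _), sqMat, Fintype.sum_prod_type,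
      Finset.smul_sum]

lemma sqNorm_prod_sq_le : (G.prod H).sqNorm ^ 2 ≤ G.valPlus * H.sqNorm ^ 2 := by
  refine sqNorm_sq_le (mul_nonneg valPlus_nonneg (sq_nonneg _)) fun d B hB => ?_
  rcases (sq_nonneg H.sqNorm).eq_or_lt with h0 | h0
  · by_contra! hlt
    rw [← h0, mul_zero] at hlt
    have hV := G.valPlus_nonneg
    have := mul_opNorm_sqMat_prod_le hB (div_pos (by linarith : 0 < G.valPlus + 1) hlt)
      (by rw [← h0, mul_zero]; exact zero_le_one)
    rw [div_mul_cancel₀ _ hlt.ne'] at this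
    linarith
  · have := mul_opNorm_sqMat_prod_le hB (inv_pos.2 h0) (inv_mul_cancel₀ h0.ne').le
    rwa [inv_mul_le_iff₀ h0, mul_comm] at this

lemma sqNorm_pow_succ_sq_le (k : ℕ) : (G.pow (k + 1)).sqNorm ^ 2 ≤ G.valPlus ^ (k + 1) := by
  induction k with
  | zero =>
    rw [zero_add, pow_one]
    exact sqNorm_sq_le valPlus_nonneg fun d B hB => opNorm_sqMat_le_valPlus hB
  | succ k ih =>
    rw [_root_.pow_succ' G.valPlus]
    exact sqNorm_prod_sq_le.trans (mul_le_mul_of_nonneg_left ih valPlus_nonneg)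

end ProjGame

/-- For every projection game `G` and every `k ≥ 1`,
`val*(G^{⊗k})² ≤ ‖G^{⊗k}‖*² ≤ (val₊*(G))^k`. -/
theorem entVal_sq_le_sqNorm_sq_le_valPlus_pow (G : ProjGame) (k : ℕ) (hk : 1 ≤ k) :
    (G.pow k).entVal ^ 2 ≤ (G.pow k).sqNorm ^ 2 ∧
      (G.pow k).sqNorm ^ 2 ≤ G.valPlus ^ k := by
  obtain ⟨k, rfl⟩ := Nat.exists_eq_add_of_le' hk
  exact ⟨ProjGame.entVal_sq_le_sqNorm_sq, ProjGame.sqNorm_pow_succ_sq_le k⟩
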